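/- For every positive integer ω, there is a function g_ω : ℕ → ℝ satisfying the following. Let Γ be an abelian group, let A ⊆ Γ be a non-empty set with |Γ \ A| ≤ ω, and let (G, γ) be a Γ-labelled graph. If arb_{(Γ,A)}(G, γ) ≥ g_ω(d), then G contains an (A, d)-cycle. -/

import Mathlib

namespace ArbPaper

universe u v

/-- The `γ`-value of a walk: the sum of the labels of its edges. -/
def walkVal {V : Type u} {Γ : Type v} [AddCommGroup Γ] {G : SimpleGraph V}
    (γ : Sym2 V → Γ) {x y : V} (w : G.Walk x y) : Γ :=
  (w.edges.map γ).sum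

/-- The set `S` induces a subgraph having no cycle of `γ`-value in `A`. -/
def NoCycleValIn {V : Type u} {Γ : Type v} [AddCommGroup Γ] (G : SimpleGraph V)
    (γ : Sym2 V → Γ) (A : Set Γ) (S : Set V) : Prop :=
  ∀ (v : V) (w : G.Walk v v), w.IsCycle → (∀ x ∈ w.support, x ∈ S) →
    walkVal γ w ∉ A

/-- The `(Γ, A)`-vertex-arboricity of the subgraph of `G` induced on `S`:
the minimum number of parts in a partition of `S` such that each part induces
a subgraph having no cycle of `γ`-value in `A`. -/
noncomputable def arbOn {V : Type u} {Γ : Type v} [AddCommGroup Γ] (G : SimpleGraph V)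
    (γ : Sym2 V → Γ) (A : Set Γ) (S : Set V) : ℕ :=
  sInf {k : ℕ | ∃ f : V → Fin k,
    ∀ i : Fin k, NoCycleValIn G γ A {v | v ∈ S ∧ f v = i}}

/-- The `(Γ, A)`-vertex-arboricity of `(G, γ)`. -/
noncomputable def arb {V : Type u} {Γ : Type v} [AddCommGroup Γ] (G : SimpleGraph V)
    (γ : Sym2 V → Γ) (A : Set Γ) : ℕ :=
  arbOn G γ A Set.univ

/-- `G` contains an `(A, d)`-cycle: a cycle of `γ`-value in `A` and length at least `d`. -/
def ContainsADCycle {V : Type u} {Γ : Type v} [AddCommGroup Γ] (G : SimpleGraph V)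
    (γ : Sym2 V → Γ) (A : Set Γ) (d : ℕ) : Prop :=
  ∃ (v : V) (w : G.Walk v v), w.IsCycle ∧ walkVal γ w ∈ A ∧ d ≤ w.length

/-- `b` (the branching vertices) together with the branching paths `P i j` (for `i < j`)
form a subdivision of the complete graph `K t` inside `G`. -/
def IsKtSubdivision {V : Type u} (G : SimpleGraph V) (t : ℕ) (b : Fin t → V)
    (P : ∀ i j : Fin t, G.Walk (b i) (b j)) : Prop :=
  Function.Injective b ∧
  (∀ i j : Fin t, i < j → (P i j).IsPath) ∧
  (∀ i j : Fin t, i < j → ∀ v ∈ (P i j).support, v ∈ Set.range b → v = b i ∨ v = b j) ∧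
  (∀ i j k l : Fin t, i < j → k < l → (i, j) ≠ (k, l) → ∀ v,
    v ∈ (P i j).support → v ∈ (P k l).support →
      (v = b i ∨ v = b j) ∧ (v = b k ∨ v = b l))

/-- `G` itself is (as a whole) a subdivision of `K t` with data `b`, `P`:
every vertex and every edge of `G` lies on some branching path. -/
def IsSpanningKtSubdivision {V : Type u} (G : SimpleGraph V) (t : ℕ) (b : Fin t → V)
    (P : ∀ i j : Fin t, G.Walk (b i) (b j)) : Prop :=
  IsKtSubdivision G t b P ∧
  (∀ v : V, ∃ i j : Fin t, i < j ∧ v ∈ (P i j).support) ∧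
  (∀ e ∈ G.edgeSet, ∃ i j : Fin t, i < j ∧ e ∈ (P i j).edges)

/-- `G` contains an `(A, d)`-subdivision of `K t`: a subdivision of `K t` in which every
branching path has `γ`-value in `A` and length at least `d`. -/
def ContainsADSubdivision {V : Type u} {Γ : Type v} [AddCommGroup Γ] (G : SimpleGraph V)
    (γ : Sym2 V → Γ) (A : Set Γ) (t d : ℕ) : Prop :=
  ∃ (b : Fin t → V) (P : ∀ i j : Fin t, G.Walk (b i) (b j)),
    IsKtSubdivision G t b P ∧
    ∀ i j : Fin t, i < j → walkVal γ (P i j) ∈ A ∧ d ≤ (P i j).length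

/-- `w` is an `X`-path lying inside the induced subgraph `G[Y]`: a path of length at
least `2` whose endpoints lie in `X`, internal vertices lie outside `X`, and all of
whose vertices lie in `Y`. -/
def IsXPathIn {V : Type u} (G : SimpleGraph V) (X Y : Set V) {x y : V}
    (w : G.Walk x y) : Prop :=
  w.IsPath ∧ 2 ≤ w.length ∧ x ∈ X ∧ y ∈ X ∧
  (∀ v ∈ w.support, v ∈ Y) ∧
  (∀ v ∈ w.support, v ≠ x → v ≠ y → v ∉ X)

/-- `(L 0, L 1, …, L p)` is a leveling of the connected graph `G`. -/
def IsLeveling {V : Type u} (G : SimpleGraph V) (p : ℕ) (L : ℕ → Set V) : Prop :=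
  (∀ i j, i ≤ p → j ≤ p → i ≠ j → Disjoint (L i) (L j)) ∧
  (∃ v : V, L 0 = {v}) ∧
  (∀ v : V, ∃ i, i ≤ p ∧ v ∈ L i) ∧
  (∀ i, 1 ≤ i → i ≤ p → ∀ v ∈ L i,
    (∃ u ∈ L (i - 1), G.Adj v u) ∧ (∀ j, j + 2 ≤ i → ∀ u ∈ L j, ¬ G.Adj v u))

/-- `G[Y]` is a connected component of `G[S]`. -/
def IsCompOf {V : Type u} (G : SimpleGraph V) (Y S : Set V) : Prop :=
  Y ⊆ S ∧ (G.induce Y).Connected ∧ ∀ u ∈ Y, ∀ v ∈ S, G.Adj u v → v ∈ Y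


/-- `S` can be partitioned into `k` parts with no cycle of value in `A`. -/
def Col {V : Type u} {Γ : Type v} [AddCommGroup Γ] (G : SimpleGraph V)
    (γ : Sym2 V → Γ) (A : Set Γ) (S : Set V) (k : ℕ) : Prop :=
  ∃ f : V → ℕ, (∀ v ∈ S, f v < k) ∧ ∀ i, NoCycleValIn G γ A {v | v ∈ S ∧ f v = i}

/-- The graph with the edges of `G` inside `M`. -/
def GI {V : Type u} (G : SimpleGraph V) (M : Set V) : SimpleGraph V where
  Adj u v := G.Adj u v ∧ u ∈ M ∧ v ∈ M
  symm := ⟨fun _ _ h => ⟨h.1.symm, h.2.2, h.2.1⟩⟩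
  loopless := ⟨fun _ h => h.1.ne rfl⟩

/-- `G[M]` is connected (or empty). -/
def Conn {V : Type u} (G : SimpleGraph V) (M : Set V) : Prop :=
  ∀ u ∈ M, ∀ v ∈ M, (GI G M).Reachable u v

section
variable {V : Type u} {Γ : Type v} [AddCommGroup Γ] {G : SimpleGraph V}
  {γ : Sym2 V → Γ} {A : Set Γ}

lemma walkVal_nil {x : V} : walkVal γ (SimpleGraph.Walk.nil : G.Walk x x) = 0 := by
  simp [walkVal]

lemma walkVal_cons {x y z : V} (h : G.Adj x y) (p : G.Walk y z) :
    walkVal γ (SimpleGraph.Walk.cons h p) = γ s(x, y) + walkVal γ p := by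
  simp [walkVal]

lemma walkVal_append {x y z : V} (p : G.Walk x y) (q : G.Walk y z) :
    walkVal γ (p.append q) = walkVal γ p + walkVal γ q := by
  simp [walkVal, SimpleGraph.Walk.edges_append]

lemma walkVal_concat {x y z : V} (p : G.Walk x y) (h : G.Adj y z) :
    walkVal γ (p.concat h) = walkVal γ p + γ s(y, z) := by
  simp [walkVal, SimpleGraph.Walk.edges_concat]

lemma isPath_append {x y z : V} {p : G.Walk x y} {q : G.Walk y z} (hp : p.IsPath)
    (hq : q.IsPath) (h : ∀ v ∈ p.support, v ∈ q.support → v = y) : (p.append q).IsPath := by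
  induction p with
  | nil => simpa using hq
  | cons e p ih =>
    rw [SimpleGraph.Walk.cons_isPath_iff] at hp
    rw [SimpleGraph.Walk.cons_append, SimpleGraph.Walk.cons_isPath_iff]
    refine ⟨ih hp.1 hq (fun v hv => h v (by simp [hv])), ?_⟩
    rw [SimpleGraph.Walk.mem_support_append_iff]
    rintro (h1 | h1)
    · exact hp.2 h1
    · have := h _ (by simp) h1
      exact hp.2 (this ▸ p.end_mem_support)

lemma walk_closed {S T : Set V} (hST : ∀ u v, u ∈ S → v ∈ S → G.Adj u v → u ∈ T → v ∈ T)
    {x y : V} (w : G.Walk x y) (hw : ∀ v ∈ w.support, v ∈ S) (hx : x ∈ T) :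
    ∀ v ∈ w.support, v ∈ T := by
  induction w with
  | nil => simpa using hx
  | cons e p ih =>
    intro v hv
    simp only [SimpleGraph.Walk.support_cons, List.mem_cons] at hv hw
    rcases hv with rfl | hv
    · exact hx
    · exact ih (fun u hu => hw u (Or.inr hu))
        (hST _ _ (hw _ (Or.inl rfl)) (hw _ (Or.inr p.start_mem_support)) e hx) v hv

lemma path_closed {S T : Set V} {y : V}
    (hST : ∀ u v, u ∈ S → v ∈ S → v ≠ y → G.Adj u v → u ∈ T → v ∈ T)
    {x : V} (w : G.Walk x y) (hp : w.IsPath) (hw : ∀ v ∈ w.support, v ∈ S) (hx : x ∈ T) :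
    ∀ v ∈ w.support, v ∈ T ∨ v = y := by
  induction w with
  | nil => simp
  | @cons a b c e p ih =>
    intro v hv
    rw [SimpleGraph.Walk.cons_isPath_iff] at hp
    simp only [SimpleGraph.Walk.support_cons, List.mem_cons] at hv hw
    rcases hv with rfl | hv
    · exact Or.inl hx
    · by_cases hb : b = c
      · subst hb
        have := (SimpleGraph.Walk.isPath_iff_nil.1 hp.1).eq_nil
        subst this
        simp at hv
        exact Or.inr hv
      · exact ih hST hp.1 (fun u hu => hw u (Or.inr hu))
          (hST _ _ (hw _ (Or.inl rfl)) (hw _ (Or.inr p.start_mem_support)) hb e hx) v hv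

lemma Col.mono {S : Set V} {k l : ℕ} (h : Col G γ A S k) (hkl : k ≤ l) : Col G γ A S l := by
  obtain ⟨f, h1, h2⟩ := h
  exact ⟨f, fun v hv => (h1 v hv).trans_le hkl, h2⟩

lemma NoCycleValIn.mono {S T : Set V} (h : NoCycleValIn G γ A T) (hST : S ⊆ T) :
    NoCycleValIn G γ A S := fun v w hw hs => h v w hw (fun x hx => hST (hs x hx))

lemma noCycle_subsingleton {S : Set V} (hS : S.Subsingleton) : NoCycleValIn G γ A S := by
  intro v w hw hs
  exfalso
  cases w with
  | nil => exact SimpleGraph.Walk.not_isCycle_nil hw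
  | cons e p =>
    exact e.ne (hS (hs _ (by simp)) (hs _ (by simp)))

lemma exists_cycle {S : Set V} {k : ℕ} (hk : 1 ≤ k) (h : ¬ Col G γ A S k) :
    ∃ (v : V) (w : G.Walk v v), w.IsCycle ∧ (∀ x ∈ w.support, x ∈ S) ∧ walkVal γ w ∈ A := by
  by_contra hc
  push Not at hc
  exact h ⟨fun _ => 0, fun _ _ => hk, fun i v w hw hs => hc v w hw (fun x hx => (hs x hx).1)⟩

lemma col_diff_singleton {S : Set V} {k : ℕ} {y : V} (h : Col G γ A (S \ {y}) k) :
    Col G γ A S (k + 1) := by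
  classical
  obtain ⟨f, h1, h2⟩ := h
  refine ⟨fun v => if v = y then k else f v, ?_, ?_⟩
  · intro v hv
    by_cases hvy : v = y
    · simp [hvy]
    · have := h1 v ⟨hv, hvy⟩
      simp [hvy]; omega
  · intro i
    by_cases hi : i = k
    · subst hi
      apply noCycle_subsingleton
      intro a ha b hb
      have key : ∀ a ∈ {v | v ∈ S ∧ (if v = y then i else f v) = i}, a = y := by
        rintro a ⟨ha, hb⟩
        by_contra hay
        have := h1 a ⟨ha, hay⟩
        simp [hay] at hb
        omega
      rw [key a ha, key b hb]
    · refine (h2 i).mono ?_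
      rintro v ⟨hv, hvi⟩
      by_cases hvy : v = y
      · simp [hvy] at hvi; omega
      · simp [hvy] at hvi
        exact ⟨⟨hv, hvy⟩, hvi⟩

lemma glue {N P Q Y : Set V} {k : ℕ} (hY : Y.Subsingleton) (hYN : Y ⊆ N)
    (hPQ : N \ Y = P ∪ Q) (hd : Disjoint P Q)
    (hadj : ∀ u ∈ P, ∀ v ∈ Q, ¬ G.Adj u v)
    (h1 : Col G γ A (P ∪ Y) k) (h2 : Col G γ A (Q ∪ Y) k) : Col G γ A N k := by
  classical
  obtain ⟨f, hf, hf'⟩ := h1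
  obtain ⟨g, hg, hg'⟩ := h2
  have : ∃ σ : ℕ ≃ ℕ, (∀ n < k, σ n < k) ∧ ∀ y ∈ Y, σ (f y) = g y := by
    rcases hY.eq_empty_or_singleton with rfl | ⟨y, rfl⟩
    · exact ⟨Equiv.refl _, by simp, by simp⟩
    · refine ⟨Equiv.swap (f y) (g y), ?_, by simp⟩
      intro n hn
      have := hf y (by simp)
      have := hg y (by simp)
      rw [Equiv.swap_apply_def]
      split_ifs <;> assumption
  obtain ⟨σ, hσ, hσY⟩ := this
  have mem : ∀ v ∈ N, v ∈ P ∨ v ∈ Q ∨ v ∈ Y := by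
    intro v hv
    by_cases hy : v ∈ Y
    · exact Or.inr (Or.inr hy)
    · have : v ∈ P ∪ Q := hPQ ▸ ⟨hv, hy⟩
      rcases this with h | h <;> simp [h]
  have memP : ∀ v ∈ P, v ∈ N ∧ v ∉ Y := fun v hv => by
    have : v ∈ N \ Y := hPQ ▸ Or.inl hv
    exact this
  have memQ : ∀ v ∈ Q, v ∈ N ∧ v ∉ Y := fun v hv => by
    have : v ∈ N \ Y := hPQ ▸ Or.inr hv
    exact this
  have dj : ∀ v ∈ P, v ∉ Q := fun v hv hv' => Set.disjoint_left.1 hd hv hv'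
  refine ⟨fun v => if v ∈ P then σ (f v) else g v, ?_, ?_⟩
  · intro v hv
    rcases mem v hv with h | h | h
    · simp only [h, if_true]; exact hσ _ (hf v (Or.inl h))
    · have : v ∉ P := fun h' => dj v h' h
      simp only [this, if_false]; exact hg v (Or.inl h)
    · have : v ∉ P := fun h' => (memP v h').2 h
      simp only [this, if_false]; exact hg v (Or.inr h)
  · intro i v w hw hs
    -- the support lies on one side
    have side : (∀ x ∈ w.support, x ∈ P ∪ Y) ∨ (∀ x ∈ w.support, x ∈ Q ∪ Y) := by
      by_cases hy : ∃ y ∈ w.support, y ∈ Y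
      · obtain ⟨y, hyw, hyY⟩ := hy
        have hYy : ∀ z ∈ Y, z = y := fun z hz => hY hz hyY
        have hc := hw.rotate hyw
        have hsup : ∀ x, x ∈ w.support → x ∈ (w.rotate y hyw).support := by
          intro x hx
          exact (SimpleGraph.Walk.mem_support_rotate_iff _ _ _).2 hx
        have hsup' : ∀ x, x ∈ (w.rotate y hyw).support → x ∈ N := by
          intro x hx
          exact (hs x ((SimpleGraph.Walk.mem_support_rotate_iff _ _ _).1 hx)).1
        generalize w.rotate y hyw = c at hc hsup hsup'
        cases c with
        | nil => exact absurd hc SimpleGraph.Walk.not_isCycle_nil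
        | @cons _ b _ e p =>
          rw [SimpleGraph.Walk.cons_isCycle_iff] at hc
          have hpN : ∀ v ∈ p.support, v ∈ N := fun v hv => hsup' v (by simp [hv])
          have hb : b ∈ N := hpN b p.start_mem_support
          rcases mem b hb with h | h | h
          · left
            have := path_closed (S := N) (T := P) (y := y) (by
              intro u v hu hv hvy huv huP
              rcases mem v hv with h | h | h
              · exact h
              · exact absurd huv (hadj u huP v h)
              · exact absurd (hYy v h) hvy) p hc.1 hpN h
            intro x hx
            have hx := hsup x hx
            simp only [SimpleGraph.Walk.support_cons, List.mem_cons] at hx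
            rcases hx with rfl | hx
            · exact Or.inr hyY
            · rcases this x hx with h | rfl
              · exact Or.inl h
              · exact Or.inr hyY
          · right
            have := path_closed (S := N) (T := Q) (y := y) (by
              intro u v hu hv hvy huv huP
              rcases mem v hv with h | h | h
              · exact absurd huv.symm (hadj v h u huP)
              · exact h
              · exact absurd (hYy v h) hvy) p hc.1 hpN h
            intro x hx
            have hx := hsup x hx
            simp only [SimpleGraph.Walk.support_cons, List.mem_cons] at hx
            rcases hx with rfl | hx
            · exact Or.inr hyY
            · rcases this x hx with h | rfl
              · exact Or.inl h
              · exact Or.inr hyY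
          · exact absurd (hYy b h).symm e.ne
      · push Not at hy
        have hS : ∀ x ∈ w.support, x ∈ P ∪ Q := fun x hx => by
          rcases mem x (hs x hx).1 with h | h | h
          · exact Or.inl h
          · exact Or.inr h
          · exact absurd h (hy x hx)
        rcases hS v w.start_mem_support with h | h
        · left
          intro x hx
          refine Or.inl (walk_closed (S := P ∪ Q) (T := P) ?_ w hS h x hx)
          rintro u v hu (hv | hv) huv huP
          · exact hv
          · exact absurd huv (hadj u huP v hv)
        · right
          intro x hx
          refine Or.inl (walk_closed (S := P ∪ Q) (T := Q) ?_ w hS h x hx)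
          rintro u v hu (hv | hv) huv huP
          · exact absurd huv.symm (hadj v hv u huP)
          · exact hv
    rcases side with side | side
    · refine hf' (σ.symm i) v w hw ?_
      intro x hx
      refine ⟨side x hx, ?_⟩
      have h := (hs x hx).2
      rw [Equiv.eq_symm_apply]
      rcases side x hx with hP | hy
      · simpa [hP] using h
      · have : x ∉ P := fun h' => (memP x h').2 hy
        simp only [this, if_false] at h
        rw [hσY x hy, h]
    · refine hg' i v w hw ?_
      intro x hx
      refine ⟨side x hx, ?_⟩
      have h := (hs x hx).2
      have : x ∉ P := by
        rcases side x hx with hq | hy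
        · exact fun h' => dj x h' hq
        · exact fun h' => (memP x h').2 hy
      simpa [this] using h

lemma crit [Finite V] {S : Set V} {k : ℕ} (h : ¬ Col G γ A S k) :
    ∃ N ⊆ S, ¬ Col G γ A N k ∧ ∀ Y : Set V, Y.Subsingleton → Conn G (N \ Y) := by
  obtain ⟨N, hNS, hmin⟩ := exists_minimal_le_of_wellFoundedLT (fun N => ¬ Col G γ A N k) S h
  refine ⟨N, hNS, hmin.prop, ?_⟩
  have hmin' : ∀ T : Set V, T ⊆ N → T ≠ N → Col G γ A T k := by
    intro T hT hne
    by_contra hc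
    exact hne (Set.Subset.antisymm hT (hmin.le_of_le hc hT))
  intro Y hY u hu v hv
  by_contra hreach
  apply hmin.prop
  have hY' : (Y ∩ N).Subsingleton := hY.anti Set.inter_subset_left
  apply glue (N := N) (P := {x | x ∈ N \ Y ∧ (GI G (N \ Y)).Reachable u x})
    (Q := {x | x ∈ N \ Y ∧ ¬ (GI G (N \ Y)).Reachable u x}) (Y := Y ∩ N) hY'
    Set.inter_subset_right
  · ext x
    simp only [Set.mem_sdiff, Set.mem_inter_iff, Set.mem_union, Set.mem_ofPred_eq]
    tauto
  · rw [Set.disjoint_left]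
    rintro x hx hx'
    exact hx'.2 hx.2
  · rintro a ⟨ha, ha'⟩ b ⟨hb, hb'⟩ hab
    apply hb'
    refine ha'.trans (SimpleGraph.Adj.reachable ?_)
    exact ⟨hab, ha, hb⟩
  · apply hmin'
    · rintro x (hx | hx)
      · exact hx.1.1
      · exact hx.2
    · intro heq
      have : v ∈ N := hv.1
      rw [← heq] at this
      rcases this with h | h
      · exact hreach h.2
      · exact hv.2 h.1
  · apply hmin'
    · rintro x (hx | hx)
      · exact hx.1.1
      · exact hx.2
    · intro heq
      have : u ∈ N := hu.1
      rw [← heq] at this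
      rcases this with h | h
      · exact h.2 (SimpleGraph.Reachable.refl _)
      · exact hu.2 h.1

lemma bfs {M : Set V} (hM : Conn G M) {r : V} (hr : r ∈ M) :
    ∃ D : V → ℕ, (∀ u ∈ M, ∀ v ∈ M, G.Adj u v → D v ≤ D u + 1) ∧
      ∀ v ∈ M, ∃ w : G.Walk r v, w.IsPath ∧ (∀ u ∈ w.support, u ∈ M) ∧
        (∀ u ∈ w.support, D u = D v → u = v) ∧ w.length = D v := by
  classical
  have hle : GI G M ≤ G := fun u v h => h.1
  refine ⟨(GI G M).dist r, ?_, ?_⟩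
  · intro u hu v hv huv
    obtain ⟨w, hw⟩ := (hM r hr u hu).exists_walk_length_eq_dist
    have := SimpleGraph.dist_le (w.concat (show (GI G M).Adj u v from ⟨huv, hu, hv⟩))
    rw [SimpleGraph.Walk.length_concat] at this
    omega
  · intro v hv
    obtain ⟨w, hw⟩ := (hM r hr v hv).exists_walk_length_eq_dist
    refine ⟨w.mapLe hle, ?_, ?_, ?_, ?_⟩
    · exact (w.isPath_of_length_eq_dist hw).mapLe hle
    · rw [SimpleGraph.Walk.support_mapLe_eq_support]
      exact walk_closed (S := Set.univ) (T := M) (G := GI G M)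
        (fun a b _ _ hab _ => (hab : G.Adj a b ∧ a ∈ M ∧ b ∈ M).2.2) w (by simp) hr
    · rw [SimpleGraph.Walk.support_mapLe_eq_support]
      intro u hu huv
      by_contra hne
      have h1 := w.length_takeUntil_lt_length hu hne
      have h2 := SimpleGraph.dist_le (w.takeUntil u hu)
      omega
    · rw [SimpleGraph.Walk.length_mapLe, hw]

lemma level [Finite V] {M : Set V} (hM : Conn G M) {r : V} (hr : r ∈ M) {k : ℕ} (hk : 1 ≤ k)
    (h : ¬ Col G γ A M (2 * k)) :
    ∃ N ⊆ M, ¬ Col G γ A N k ∧ (∀ Y : Set V, Y.Subsingleton → Conn G (N \ Y)) ∧ r ∉ N ∧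
      ∀ x ∈ N, ∃ w : G.Walk r x, w.IsPath ∧ (∀ u ∈ w.support, u ∈ M) ∧
        (∀ u ∈ w.support, u ∈ N → u = x) := by
  classical
  obtain ⟨D, hD, hT⟩ := bfs hM hr
  have : ∃ j, ¬ Col G γ A {v | v ∈ M ∧ D v = j} k := by
    by_contra hc
    push Not at hc
    choose F hF hF' using hc
    apply h
    refine ⟨fun v => 2 * F (D v) v + D v % 2, ?_, ?_⟩
    · intro v hv
      have := hF (D v) v ⟨hv, rfl⟩
      have := Nat.mod_lt (D v) (show 0 < 2 by norm_num)
      dsimp only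
      omega
    · intro i v w hw hs
      have hlev := walk_closed (S := {x | x ∈ M ∧ 2 * F (D x) x + D x % 2 = i})
        (T := {x | D x = D v}) (by
          rintro a b ⟨ha, ha'⟩ ⟨hb, hb'⟩ hab hav
          have h1 := hD a ha b hb hab
          have h2 := hD b hb a ha hab.symm
          simp only [Set.mem_ofPred_eq] at hav ⊢
          omega) w hs rfl
      refine hF' (D v) (i / 2) v w hw ?_
      intro x hx
      have h1 := hlev x hx
      obtain ⟨h2, h3⟩ := hs x hx
      simp only [Set.mem_ofPred_eq] at h1
      dsimp only at h3
      rw [h1] at h3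
      exact ⟨⟨h2, h1⟩, by omega⟩
  obtain ⟨j, hj⟩ := this
  obtain ⟨N, hNS, hN, hconn⟩ := crit hj
  refine ⟨N, fun x hx => (hNS hx).1, hN, hconn, ?_, ?_⟩
  · intro hrN
    have hrj := (hNS hrN).2
    apply hj
    have hD0 : D r = 0 := by
      obtain ⟨w, hw, _, _, hl⟩ := hT r hr
      have := (SimpleGraph.Walk.isPath_iff_nil.1 hw).eq_nil
      subst this
      simpa using hl.symm
    refine ⟨fun _ => 0, fun _ _ => hk, fun i => noCycle_subsingleton ?_⟩
    have key : ∀ a ∈ M, D a = j → a = r := by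
      intro a ha haj
      obtain ⟨w, _, _, _, hl⟩ := hT a ha
      exact (SimpleGraph.Walk.eq_of_length_eq_zero (p := w) (by omega)).symm
    rintro a ⟨⟨ha, ha'⟩, -⟩ b ⟨⟨hb, hb'⟩, -⟩
    rw [key a ha ha', key b hb hb']
  · intro x hx
    obtain ⟨w, h1, h2, h3, h4⟩ := hT x (hNS hx).1
    exact ⟨w, h1, h2, fun u hu huN => h3 u hu (by rw [(hNS huN).2, (hNS hx).2])⟩

lemma walk_potential {N : Set V} {K : AddSubgroup Γ} {φ : V → Γ}
    (h : ∀ x ∈ N, ∀ y ∈ N, G.Adj x y → φ x - φ y - γ s(y, x) ∈ K) {u v : V} (w : G.Walk u v)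
    (hw : ∀ x ∈ w.support, x ∈ N) : φ u - φ v - walkVal γ w ∈ K := by
  induction w with
  | nil => simp [walkVal_nil]
  | @cons a b c e p ih =>
    have h1 := ih (fun x hx => hw x (by simp [hx]))
    have h2 := h a (hw a (by simp)) b (hw b (by simp)) e
    rw [walkVal_cons]
    have := K.add_mem h2 h1
    rw [Sym2.eq_swap] at this
    convert this using 1
    abel

lemma gadget [Finite V] {M : Set V} (hM : Conn G M) {r : V} (hr : r ∈ M) {k : ℕ}
    (h : ¬ Col G γ A M (2 * (k + 1))) (K : AddSubgroup Γ) :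
    (∃ N ⊆ M, ¬ Col G γ A N (k + 1) ∧
      ∀ (v : V) (w : G.Walk v v), w.IsCycle → (∀ x ∈ w.support, x ∈ N) → walkVal γ w ∈ K) ∨
    (∃ M' ⊆ M, ∃ x ∈ M', Conn G M' ∧ ¬ Col G γ A M' k ∧ ∃ P Q : G.Walk r x,
      (P.IsPath ∧ (∀ u ∈ P.support, u ∈ M) ∧ (∀ u ∈ P.support, u ∈ M' → u = x)) ∧
      (Q.IsPath ∧ (∀ u ∈ Q.support, u ∈ M) ∧ (∀ u ∈ Q.support, u ∈ M' → u = x)) ∧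
      walkVal γ P - walkVal γ Q ∉ K) := by
  classical
  obtain ⟨N, hNM, hN, hconn, -, hT⟩ := level hM hr (by omega) h
  choose T hT1 hT2 hT3 using hT
  let φ : V → Γ := fun x => if hx : x ∈ N then walkVal γ (T x hx) else 0
  have hφ : ∀ x (hx : x ∈ N), φ x = walkVal γ (T x hx) := fun x hx => by simp [φ, hx]
  by_cases hall : ∀ x ∈ N, ∀ y ∈ N, G.Adj x y → φ x - φ y - γ s(y, x) ∈ K
  · left
    refine ⟨N, hNM, hN, fun v w _ hs => ?_⟩
    have := walk_potential (φ := φ) hall w hs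
    simpa using this
  · right
    push Not at hall
    obtain ⟨x, hx, y, hy, hxy, hK⟩ := hall
    refine ⟨N \ {y}, fun v hv => hNM hv.1, x, ⟨hx, hxy.ne⟩, hconn _ Set.subsingleton_singleton,
      fun hc => hN (col_diff_singleton hc), T x hx, (T y hy).concat hxy.symm,
      ⟨hT1 x hx, hT2 x hx, fun u hu hu' => hT3 x hx u hu hu'.1⟩, ⟨?_, ?_, ?_⟩, ?_⟩
    · exact (hT1 y hy).concat (fun hxs => hxy.ne (hT3 y hy x hxs hx)) _
    · intro u hu
      rw [SimpleGraph.Walk.support_concat] at hu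
      simp only [List.concat_eq_append, List.mem_append, List.mem_singleton] at hu
      rcases hu with hu | rfl
      · exact hT2 y hy u hu
      · exact hNM hx
    · intro u hu hu'
      rw [SimpleGraph.Walk.support_concat] at hu
      simp only [List.concat_eq_append, List.mem_append, List.mem_singleton] at hu
      rcases hu with hu | rfl
      · exact absurd (hT3 y hy u hu hu'.1) hu'.2
      · rfl
    · rw [walkVal_concat, ← sub_sub, ← hφ, ← hφ]
      exact hK

/-- There is a path from `r` to `x` inside `Z` of length at least `n` and value `s`,
meeting `M` only in `x`. -/
def Chain (G : SimpleGraph V) (γ : Sym2 V → Γ) (r x : V) (Z M : Set V) (n : ℕ) (s : Γ) : Prop :=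
  ∃ p : G.Walk r x, p.IsPath ∧ (∀ v ∈ p.support, v ∈ Z) ∧ (∀ v ∈ p.support, v ∈ M → v = x) ∧
    walkVal γ p = s ∧ n ≤ p.length

lemma Chain.extend {r x x' : V} {Z M M' : Set V} {n : ℕ} {s : Γ} (h : Chain G γ r x Z M n s)
    (hMZ : M ⊆ Z) (hM' : M' ⊆ M) {P : G.Walk x x'} (hP : P.IsPath)
    (hPM : ∀ u ∈ P.support, u ∈ M) (hPM' : ∀ u ∈ P.support, u ∈ M' → u = x') :
    Chain G γ r x' Z M' (n + P.length) (s + walkVal γ P) := by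
  obtain ⟨p, h1, h2, h3, h4, h5⟩ := h
  refine ⟨p.append P, isPath_append h1 hP (fun v hv hv' => h3 v hv (hPM v hv')), ?_, ?_, ?_, ?_⟩
  · intro v hv
    rw [SimpleGraph.Walk.mem_support_append_iff] at hv
    rcases hv with hv | hv
    · exact h2 v hv
    · exact hMZ (hPM v hv)
  · intro v hv hvM
    rw [SimpleGraph.Walk.mem_support_append_iff] at hv
    rcases hv with hv | hv
    · have := h3 v hv (hM' hvM)
      subst this
      exact hPM' v P.start_mem_support hvM
    · exact hPM' v hv hvM
  · rw [walkVal_append, h4]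
  · rw [SimpleGraph.Walk.length_append]
    omega

lemma Chain.le {r x : V} {Z M : Set V} {n n' : ℕ} {s : Γ} (h : Chain G γ r x Z M n s)
    (hn : n' ≤ n) : Chain G γ r x Z M n' s := by
  obtain ⟨p, h1, h2, h3, h4, h5⟩ := h
  exact ⟨p, h1, h2, h3, h4, hn.trans h5⟩

lemma plain [Finite V] {r : V} {Z : Set V} {k : ℕ} (hk : 1 ≤ k) (n : ℕ) :
    ∀ (l : ℕ) (M : Set V) (x : V) (s : Γ), M ⊆ Z → x ∈ M → Conn G M →
      ¬ Col G γ A M (2 ^ n * k) → Chain G γ r x Z M l s →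
      ∃ (M' : Set V) (x' : V) (s' : Γ), M' ⊆ Z ∧ x' ∈ M' ∧ Conn G M' ∧ ¬ Col G γ A M' k ∧
        Chain G γ r x' Z M' (l + n) s' := by
  induction n with
  | zero =>
    intro l M x s h1 h2 h3 h4 h5
    exact ⟨M, x, s, h1, h2, h3, by simpa using h4, h5⟩
  | succ n ih =>
    intro l M x s h1 h2 h3 h4 h5
    have hpos : 1 ≤ 2 ^ n * k := Nat.mul_pos (by positivity) hk
    obtain ⟨N, hNM, hN, hconn, hxN, hT⟩ := level (k := 2 ^ n * k) h3 h2 hpos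
      (by rw [← mul_assoc, ← pow_succ']; exact h4)
    obtain ⟨x', w', -, hs, -⟩ := exists_cycle hpos hN
    have hx' : x' ∈ N := hs x' w'.start_mem_support
    obtain ⟨P, hP1, hP2, hP3⟩ := hT x' hx'
    have hlen : 1 ≤ P.length := by
      by_contra hc
      have := SimpleGraph.Walk.eq_of_length_eq_zero (p := P) (by omega)
      exact hxN (this ▸ hx')
    have hconn' : Conn G N := by simpa using hconn ∅ Set.subsingleton_empty
    obtain ⟨M', x'', s', g1, g2, g3, g4, g5⟩ := ih (l + 1) N x' _ (hNM.trans h1) hx' hconn' hN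
      ((h5.extend h1 hNM hP1 hP2 hP3).le (by omega))
    exact ⟨M', x'', s', g1, g2, g3, g4, g5.le (by omega)⟩

lemma close_cycle {r x : V} {Z : Set V} {p : G.Walk r x} {R : G.Walk x r} (hp : p.IsPath)
    (hR : R.IsPath) (hpZ : ∀ v ∈ p.support, v ∈ Z)
    (hRZ : ∀ v ∈ R.support, v ∈ Z → v = x ∨ v = r) (hl : 2 ≤ p.length) :
    (p.append R).IsCycle := by
  cases p with
  | nil => simp at hl
  | @cons _ b _ e q =>
    rw [SimpleGraph.Walk.cons_isPath_iff] at hp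
    rw [SimpleGraph.Walk.cons_append, SimpleGraph.Walk.cons_isCycle_iff]
    have hqZ : ∀ v ∈ q.support, v ∈ Z := fun v hv => hpZ v (by simp [hv])
    constructor
    · apply isPath_append hp.1 hR
      intro v hv hvR
      rcases hRZ v hvR (hqZ v hv) with h | h
      · exact h
      · subst h; exact absurd hv hp.2
    · rw [SimpleGraph.Walk.edges_append, List.mem_append]
      rintro (h | h)
      · exact hp.2 (q.fst_mem_support_of_mem_edges h)
      · have hb := R.snd_mem_support_of_mem_edges h
        rcases hRZ b hb (hqZ b q.start_mem_support) with h' | h'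
        · subst h'
          have := (SimpleGraph.Walk.isPath_iff_nil.1 hp.1).eq_nil
          subst this
          simp at hl
        · exact e.ne h'.symm

/-- The stabilizer of a finite set. -/
def stab (S : Finset Γ) : AddSubgroup Γ where
  carrier := {g | ∀ s, s ∈ S ↔ g + s ∈ S}
  zero_mem' := by simp
  add_mem' := by
    intro a b ha hb s
    rw [hb s, ha (b + s), add_assoc]
  neg_mem' := by
    intro a ha s
    rw [ha (-a + s), add_neg_cancel_left]

lemma mem_stab {S : Finset Γ} {g : Γ} : g ∈ stab S ↔ ∀ s, s ∈ S ↔ g + s ∈ S := Iff.rfl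

open Classical in
lemma card_grow {S : Finset Γ} {a b : Γ} (h : a - b ∉ stab S) :
    S.card + 1 ≤ (S.image (· + a) ∪ S.image (· + b)).card := by
  by_contra hc
  apply h
  have ha : (S.image (· + a)).card = S.card := Finset.card_image_of_injective _ (add_left_injective a)
  have hb : (S.image (· + b)).card = S.card := Finset.card_image_of_injective _ (add_left_injective b)
  have ha' : S.image (· + a) = S.image (· + a) ∪ S.image (· + b) :=
    Finset.eq_of_subset_of_card_le Finset.subset_union_left (by omega)
  have hb' : S.image (· + b) = S.image (· + a) ∪ S.image (· + b) :=
    Finset.eq_of_subset_of_card_le Finset.subset_union_right (by omega)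
  have hab : S.image (· + a) = S.image (· + b) := ha'.trans hb'.symm
  have key : ∀ t, t - a ∈ S ↔ t - b ∈ S := by
    intro t
    have := Finset.ext_iff.1 hab t
    simp only [Finset.mem_image] at this
    constructor
    · intro ht
      obtain ⟨s, hs, hst⟩ := this.1 ⟨_, ht, by abel⟩
      rwa [← hst, add_sub_cancel_right]
    · intro ht
      obtain ⟨s, hs, hst⟩ := this.2 ⟨_, ht, by abel⟩
      rwa [← hst, add_sub_cancel_right]
  rw [mem_stab]
  intro s
  have := key (s + a)
  rw [add_sub_cancel_right] at this
  rw [this]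
  have e : s + a - b = a - b + s := by abel
  rw [e]

/-- Threshold for the growing step. -/
def cFun (k' : ℕ) : ℕ → ℕ
  | 0 => 1
  | m + 1 => 2 * (cFun k' m + k' + 1)

lemma one_le_cFun (k' m : ℕ) : 1 ≤ cFun k' m := by
  cases m <;> simp [cFun]; omega

lemma grow [Finite V] {ω d k' : ℕ} {Goal : Prop} {H : AddSubgroup Γ} {Z : Set V} {r : V}
    (hA : (Aᶜ : Set Γ).encard ≤ (ω : ℕ∞)) (haH : ∃ a ∈ A, a ∈ H)
    (hrec : ∀ K : AddSubgroup Γ, K < H → Finite K → Nat.card K ≤ ω → ∀ N : Set V,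
      ¬ Col G γ A N k' →
      (∀ (v : V) (w : G.Walk v v), w.IsCycle → (∀ x ∈ w.support, x ∈ N) → walkVal γ w ∈ K) → Goal)
    (hclose : ∀ x ∈ Z, ∃ ρ : Γ, ∀ (M : Set V) (s : Γ), Chain G γ r x Z M (d + 2) s →
      s + ρ ∈ H ∧ (s + ρ ∈ A → Goal)) (m : ℕ) :
    ∀ (M : Set V) (x : V) (S : Finset Γ), M ⊆ Z → x ∈ M → Conn G M →
      ¬ Col G γ A M (cFun k' m) → S.Nonempty → (∀ s ∈ S, Chain G γ r x Z M (d + 2) s) →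
      ω + 1 ≤ S.card + m → Goal := by
  classical
  induction m with
  | zero =>
    intro M x S hMZ hx _ _ _ hS hcard
    obtain ⟨ρ, hρ⟩ := hclose x (hMZ hx)
    by_contra hG
    have hsub : ((S.image (· + ρ) : Finset Γ) : Set Γ) ⊆ Aᶜ := by
      intro t ht
      simp only [Finset.coe_image, Set.mem_image, Finset.mem_coe] at ht
      obtain ⟨s, hs, rfl⟩ := ht
      exact fun hA' => hG ((hρ M s (hS s hs)).2 hA')
    have h1 := (Set.encard_le_encard hsub).trans hA
    rw [Set.encard_coe_eq_coe_finsetCard,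
      Finset.card_image_of_injective _ (add_left_injective ρ)] at h1
    have : S.card ≤ ω := by exact_mod_cast h1
    omega
  | succ m ih =>
    intro M x S hMZ hx hM hcol hSn hS hcard
    obtain ⟨ρ, hρ⟩ := hclose x (hMZ hx)
    by_contra hG
    have hsub : ((S.image (· + ρ) : Finset Γ) : Set Γ) ⊆ Aᶜ := by
      intro t ht
      simp only [Finset.coe_image, Set.mem_image, Finset.mem_coe] at ht
      obtain ⟨s, hs, rfl⟩ := ht
      exact fun hA' => hG ((hρ M s (hS s hs)).2 hA')
    have h1 := (Set.encard_le_encard hsub).trans hA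
    rw [Set.encard_coe_eq_coe_finsetCard,
      Finset.card_image_of_injective _ (add_left_injective ρ)] at h1
    have hSω : S.card ≤ ω := by exact_mod_cast h1
    obtain ⟨s0, hs0⟩ := hSn
    have hs0H := (hρ M s0 (hS s0 hs0)).1
    have hKH : stab S ≤ H := by
      intro g hg
      have h2 := (hρ M (g + s0) (hS _ ((mem_stab.1 hg s0).1 hs0))).1
      have := H.sub_mem h2 hs0H
      convert this using 1
      abel
    have hKne : stab S ≠ H := by
      intro he
      obtain ⟨a, haA, haH⟩ := haH
      have h2 : a - (s0 + ρ) ∈ stab S := by rw [he]; exact H.sub_mem haH hs0H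
      have h3 := (mem_stab.1 h2 s0).1 hs0
      apply hG
      apply (hρ M _ (hS _ h3)).2
      convert haA using 1
      abel
    let ι : stab S → S := fun g => ⟨g.1 + s0, (mem_stab.1 g.2 s0).1 hs0⟩
    have hι : Function.Injective ι := by
      intro g g' hgg
      have : g.1 + s0 = g'.1 + s0 := congrArg Subtype.val hgg
      exact Subtype.ext (add_right_cancel this)
    have hfin : Finite (stab S) := Finite.of_injective ι hι
    have hKcard : Nat.card (stab S) ≤ ω := by
      have := Nat.card_le_card_of_injective ι hι
      simp at this
      omega
    rcases gadget (k := cFun k' m + k') hM hx hcol (stab S) with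
      ⟨N, hNM, hN, hcyc⟩ | ⟨M', hM'M, x', hx', hM', hcol', P, Q, hP, hQ, hPQ⟩
    · exact hG (hrec (stab S) (lt_of_le_of_ne hKH hKne) hfin hKcard N
        (fun hc => hN (hc.mono (by omega))) hcyc)
    · apply hG
      refine ih M' x' (S.image (· + walkVal γ P) ∪ S.image (· + walkVal γ Q)) (hM'M.trans hMZ) hx'
        hM' (fun hc => hcol' (hc.mono (by omega))) ⟨s0 + walkVal γ P, ?_⟩ ?_ ?_
      · simp [hs0]
      · intro t ht
        simp only [Finset.mem_union, Finset.mem_image] at ht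
        rcases ht with ⟨s, hs, rfl⟩ | ⟨s, hs, rfl⟩
        · exact ((hS s hs).extend hMZ hM'M hP.1 hP.2.1 hP.2.2).le (by omega)
        · exact ((hS s hs).extend hMZ hM'M hQ.1 hQ.2.1 hQ.2.2).le (by omega)
      · have := card_grow hPQ
        omega

/-- Threshold for one round. -/
def rFun (ω d k' : ℕ) : ℕ := 2 * (2 ^ (d + 2) * cFun k' ω)

lemma round [Finite V] {ω d k' : ℕ} {H : AddSubgroup Γ}
    (hA : (Aᶜ : Set Γ).encard ≤ (ω : ℕ∞))
    (hrec : ∀ K : AddSubgroup Γ, K < H → Finite K → Nat.card K ≤ ω → ∀ N : Set V,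
      ¬ Col G γ A N k' →
      (∀ (v : V) (w : G.Walk v v), w.IsCycle → (∀ x ∈ w.support, x ∈ N) → walkVal γ w ∈ K) →
      ContainsADCycle G γ A d)
    {N : Set V} (hN : ¬ Col G γ A N (rFun ω d k'))
    (hH : ∀ (v : V) (w : G.Walk v v), w.IsCycle → (∀ x ∈ w.support, x ∈ N) → walkVal γ w ∈ H) :
    ContainsADCycle G γ A d := by
  classical
  have hc1 := one_le_cFun k' ω
  have hpos : 1 ≤ 2 ^ (d + 2) * cFun k' ω := Nat.mul_pos (by positivity) hc1
  have hpos' : 1 ≤ rFun ω d k' := by unfold rFun; omega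
  obtain ⟨a, wa, hwa, hsa, haA⟩ := exists_cycle hpos' hN
  have haH := hH a wa hwa hsa
  obtain ⟨M0, hM0N, hM0, hconn0⟩ := crit hN
  have hconn0' : Conn G M0 := by simpa using hconn0 ∅ Set.subsingleton_empty
  obtain ⟨z, wz, -, hsz, -⟩ := exists_cycle hpos' hM0
  have hz : z ∈ M0 := hsz z wz.start_mem_support
  obtain ⟨Z, hZM, hZ, hconnZ, -, hT⟩ := level hconn0' hz hpos hM0
  have hconnZ' : Conn G Z := by simpa using hconnZ ∅ Set.subsingleton_empty
  obtain ⟨r, wr, -, hsr, -⟩ := exists_cycle hpos hZ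
  have hr : r ∈ Z := hsr r wr.start_mem_support
  obtain ⟨M, x, s, g1, g2, g3, g4, g5⟩ := plain (Z := Z) (r := r) (s := 0) hc1 (d + 2) 0 Z r
    (Set.Subset.refl Z) hr hconnZ' hZ ⟨SimpleGraph.Walk.nil, by simp, by simpa using hr, by simp,
      walkVal_nil, by simp⟩
  rw [zero_add] at g5
  refine grow (H := H) (Z := Z) (r := r) (d := d) hA ⟨_, haA, haH⟩ hrec ?_ ω M x {s} g1 g2 g3 g4
    (by simp) (by simpa using g5) (by simp [add_comm])
  intro y hy
  obtain ⟨w1, _, h12, h13⟩ := hT y hy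
  obtain ⟨w2, _, h22, h23⟩ := hT r hr
  let R := (w1.reverse.append w2).bypass
  have hR : R.IsPath := SimpleGraph.Walk.bypass_isPath _
  have hRs : ∀ v ∈ R.support, v ∈ w1.support ∨ v ∈ w2.support := by
    intro v hv
    have := SimpleGraph.Walk.support_bypass_subset_support _ hv
    rw [SimpleGraph.Walk.mem_support_append_iff] at this
    simpa using this
  refine ⟨walkVal γ R, ?_⟩
  rintro M' t ⟨p, p1, p2, p3, p4, p5⟩
  have hcyc : (p.append R).IsCycle := by
    apply close_cycle p1 hR p2 _ (by omega)
    intro v hv hvZ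
    rcases hRs v hv with h | h
    · exact Or.inl (h13 v h hvZ)
    · exact Or.inr (h23 v h hvZ)
  have hval : walkVal γ (p.append R) = t + walkVal γ R := by rw [walkVal_append, p4]
  constructor
  · rw [← hval]
    apply hH _ _ hcyc
    intro v hv
    rw [SimpleGraph.Walk.mem_support_append_iff] at hv
    apply hM0N
    rcases hv with hv | hv
    · exact hZM (p2 v hv)
    · rcases hRs v hv with h | h
      · exact h12 v h
      · exact h22 v h
  · intro hA'
    refine ⟨r, p.append R, hcyc, by rwa [hval], ?_⟩
    rw [SimpleGraph.Walk.length_append]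
    omega

/-- Threshold for all rounds. -/
def tFun (ω d : ℕ) : ℕ → ℕ
  | 0 => 0
  | h + 1 => rFun ω d (tFun ω d h)

lemma rounds [Finite V] {ω d : ℕ} (hA : (Aᶜ : Set Γ).encard ≤ (ω : ℕ∞)) (h : ℕ) :
    ∀ H : AddSubgroup Γ, Finite H → Nat.card H ≤ h → ∀ N : Set V,
      ¬ Col G γ A N (tFun ω d h) →
      (∀ (v : V) (w : G.Walk v v), w.IsCycle → (∀ x ∈ w.support, x ∈ N) → walkVal γ w ∈ H) →
      ContainsADCycle G γ A d := by
  induction h with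
  | zero =>
    intro H hf hc
    have : 0 < Nat.card H := Nat.card_pos
    omega
  | succ h ih =>
    intro H hf hc N hN hH
    refine round (k' := tFun ω d h) hA ?_ hN hH
    intro K hK hKf _ N' hN' hcyc
    refine ih K hKf ?_ N' hN' hcyc
    have : Nat.card K < Nat.card H := by
      have := Set.ncard_lt_ncard (s := (K : Set Γ)) (t := (H : Set Γ)) hK (Set.toFinite _)
      simpa [← Nat.card_coe_set_eq] using this
    omega

end

theorem statement1 (ω : ℕ) (hω : 0 < ω) :
    ∃ g : ℕ → ℝ,
      ∀ (Γ : Type v) [AddCommGroup Γ] (A : Set Γ), A.Nonempty →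
        (Aᶜ : Set Γ).encard ≤ (ω : ℕ∞) →
        ∀ (V : Type u) [Fintype V] (G : SimpleGraph V) (γ : Sym2 V → Γ) (d : ℕ),
          g d ≤ (arb G γ A : ℝ) →
          ContainsADCycle G γ A d := by
  refine ⟨fun d => (rFun ω d (tFun ω d ω) : ℝ) + 1, ?_⟩
  intro Γ _ A _ hA V _ G γ d hg
  have hcol : ¬ Col G γ A Set.univ (rFun ω d (tFun ω d ω)) := by
    rintro ⟨f, h1, h2⟩
    have hle : arb G γ A ≤ rFun ω d (tFun ω d ω) := by
      apply Nat.sInf_le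
      refine ⟨fun v => ⟨f v, h1 v trivial⟩, fun i => (h2 i).mono ?_⟩
      rintro v ⟨hv, hvi⟩
      exact ⟨hv, congrArg Fin.val hvi⟩
    have : (arb G γ A : ℝ) ≤ (rFun ω d (tFun ω d ω) : ℝ) := by exact_mod_cast hle
    linarith
  refine round (H := ⊤) (k' := tFun ω d ω) hA ?_ hcol (fun _ _ _ _ => trivial)
  intro K _ hKf hKc N hN hcyc
  exact rounds hA ω K hKf hKc N hN hcyc

end ArbPaper
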